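/- Weak formulation via the Arnold–Carlen tensor (Proposition 3.4): let f : ℝ^d → ℝ be smooth with compact support and set p := π·e^f. Then ∫_{ℝ^d} ( Γ₂(f,f)(x) + Γ_I(f,f)(x) ) p(x) dx = ∫_{ℝ^d} ( ‖∇²f(x)‖_F² + Σ_{i,j} (ℜ_AC)_{ij}(x) ∂f/∂x_i(x) ∂f/∂x_j(x) ) p(x) dx, where ∇²f is the Hessian matrix of f and the Arnold–Carlen tensor is (ℜ_AC)_{ij} = −∂²(log π)/∂x_i∂x_j − ½( ∂γ_j/∂x_i + ∂γ_i/∂x_j ). -/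

import Mathlib

open MeasureTheory
open scoped BigOperators

noncomputable section

/-- `i`-th partial derivative of `f` at `x`, in the coordinate direction `i`. -/
def pderiv' {d : ℕ} (f : EuclideanSpace ℝ (Fin d) → ℝ) (i : Fin d)
    (x : EuclideanSpace ℝ (Fin d)) : ℝ :=
  fderiv ℝ f x (EuclideanSpace.single i 1)

/-- second partial derivative `∂_i ∂_j f` at `x`. -/
def pderiv2 {d : ℕ} (f : EuclideanSpace ℝ (Fin d) → ℝ) (i j : Fin d)
    (x : EuclideanSpace ℝ (Fin d)) : ℝ :=
  pderiv' (fun y => pderiv' f j y) i x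

/-- Laplacian `Δf`. -/
def lap {d : ℕ} (f : EuclideanSpace ℝ (Fin d) → ℝ) (x : EuclideanSpace ℝ (Fin d)) : ℝ :=
  ∑ i, pderiv2 f i i x

/-- carré du champ `Γ₁(g,h) = ⟨∇g, ∇h⟩`. -/
def Gamma1 {d : ℕ} (g h : EuclideanSpace ℝ (Fin d) → ℝ) (x : EuclideanSpace ℝ (Fin d)) : ℝ :=
  ∑ i, pderiv' g i x * pderiv' h i x

/-- generator `L̃ h = ⟨∇ log π, ∇h⟩ + Δh`. -/
def genL {d : ℕ} (π h : EuclideanSpace ℝ (Fin d) → ℝ) (x : EuclideanSpace ℝ (Fin d)) : ℝ :=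
  Gamma1 (fun y => Real.log (π y)) h x + lap h x

/-- Gamma two operator `Γ₂(f,f) = ½ L̃ Γ₁(f,f) − Γ₁(L̃f, f)`. -/
def Gamma2 {d : ℕ} (π f : EuclideanSpace ℝ (Fin d) → ℝ) (x : EuclideanSpace ℝ (Fin d)) : ℝ :=
  (1/2 : ℝ) * genL π (fun y => Gamma1 f f y) x - Gamma1 (fun y => genL π f y) f x

/-- information Gamma operator `Γ_I(f,f) = −½⟨γ, ∇Γ₁(f,f)⟩ + (L̃f)·⟨∇f, γ⟩`. -/
def GammaI {d : ℕ} (π : EuclideanSpace ℝ (Fin d) → ℝ)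
    (γ : EuclideanSpace ℝ (Fin d) → EuclideanSpace ℝ (Fin d))
    (f : EuclideanSpace ℝ (Fin d) → ℝ) (x : EuclideanSpace ℝ (Fin d)) : ℝ :=
  -(1/2 : ℝ) * (∑ i, γ x i * pderiv' (fun y => Gamma1 f f y) i x)
    + genL π f x * (∑ i, pderiv' f i x * γ x i)

/-- the tensor `ℜ` of the paper:
`ℜ_{ij} = −∂²_{ij} log π + ((3−2d)/8) γ_i γ_j − (1/8) δ_{ij} Σ_k γ_k²
          + ½(γ_i ∂_j log π + γ_j ∂_i log π)`. -/
def Rtensor {d : ℕ} (π : EuclideanSpace ℝ (Fin d) → ℝ)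
    (γ : EuclideanSpace ℝ (Fin d) → EuclideanSpace ℝ (Fin d))
    (i j : Fin d) (x : EuclideanSpace ℝ (Fin d)) : ℝ :=
  -pderiv2 (fun y => Real.log (π y)) i j x
    + ((3 - 2 * (d : ℝ)) / 8) * γ x i * γ x j
    - (1/8 : ℝ) * (if i = j then ∑ k, (γ x k) ^ 2 else 0)
    + (1/2 : ℝ) * (γ x i * pderiv' (fun y => Real.log (π y)) j x
        + γ x j * pderiv' (fun y => Real.log (π y)) i x)

/-- the modified Hessian matrix `𝔥ess f`. -/
def hessM {d : ℕ} (γ : EuclideanSpace ℝ (Fin d) → EuclideanSpace ℝ (Fin d))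
    (f : EuclideanSpace ℝ (Fin d) → ℝ) (i j : Fin d) (x : EuclideanSpace ℝ (Fin d)) : ℝ :=
  if i = j then
    pderiv2 f i i x + (1/2 : ℝ) * (∑ k, γ x k * pderiv' f k x)
      - (1/2 : ℝ) * γ x i * pderiv' f i x
  else
    pderiv2 f i j x - (1/4 : ℝ) * (γ x i * pderiv' f j x + γ x j * pderiv' f i x)

/-- right-hand side of the Fokker–Planck equation `−∇·(p b) + Δp` with drift
`b = ∇ log π − γ`, evaluated at a density `p`. -/
def FPrhs {d : ℕ} (π : EuclideanSpace ℝ (Fin d) → ℝ)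
    (γ : EuclideanSpace ℝ (Fin d) → EuclideanSpace ℝ (Fin d))
    (p : EuclideanSpace ℝ (Fin d) → ℝ) (x : EuclideanSpace ℝ (Fin d)) : ℝ :=
  -(∑ i, pderiv' (fun y => p y * (pderiv' (fun z => Real.log (π z)) i y - γ y i)) i x)
    + lap p x

/-- `L̃* p = −∇·(p ∇ log π) + Δp`. -/
def Ltilstar {d : ℕ} (π p : EuclideanSpace ℝ (Fin d) → ℝ)
    (x : EuclideanSpace ℝ (Fin d)) : ℝ :=
  -(∑ i, pderiv' (fun y => p y * pderiv' (fun z => Real.log (π z)) i y) i x) + lap p x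

/-- Arnold–Carlen tensor `(ℜ_AC)_{ij} = −∂²_{ij} log π − ½(∂_i γ_j + ∂_j γ_i)`. -/
def RAC {d : ℕ} (π : EuclideanSpace ℝ (Fin d) → ℝ)
    (γ : EuclideanSpace ℝ (Fin d) → EuclideanSpace ℝ (Fin d))
    (i j : Fin d) (x : EuclideanSpace ℝ (Fin d)) : ℝ :=
  -pderiv2 (fun y => Real.log (π y)) i j x
    - (1/2 : ℝ) * (pderiv' (fun y => γ y j) i x + pderiv' (fun y => γ y i) j x)

section Calculus

variable {d : ℕ} {f g : EuclideanSpace ℝ (Fin d) → ℝ} {i j : Fin d}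
  {x : EuclideanSpace ℝ (Fin d)}

theorem ContDiff.pderiv' (hf : ContDiff ℝ (⊤ : ℕ∞) f) (i : Fin d) :
    ContDiff ℝ (⊤ : ℕ∞) (fun y => pderiv' f i y) := by
  unfold _root_.pderiv'
  exact (hf.fderiv_right (m := (⊤ : ℕ∞)) (by simp)).clm_apply contDiff_const

theorem ContDiff.gamma1 (hf : ContDiff ℝ (⊤ : ℕ∞) f) (hg : ContDiff ℝ (⊤ : ℕ∞) g) :
    ContDiff ℝ (⊤ : ℕ∞) (fun y => Gamma1 f g y) :=
  ContDiff.sum fun i _ => (hf.pderiv' i).mul (hg.pderiv' i)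

theorem pderiv'_add (hf : ContDiff ℝ (⊤ : ℕ∞) f) (hg : ContDiff ℝ (⊤ : ℕ∞) g) :
    pderiv' (fun y => f y + g y) i x = pderiv' f i x + pderiv' g i x := by
  unfold pderiv'
  rw [fderiv_fun_add (hf.differentiable (by simp) x) (hg.differentiable (by simp) x)]
  rfl

theorem pderiv'_sub (hf : ContDiff ℝ (⊤ : ℕ∞) f) (hg : ContDiff ℝ (⊤ : ℕ∞) g) :
    pderiv' (fun y => f y - g y) i x = pderiv' f i x - pderiv' g i x := by
  unfold pderiv'
  rw [fderiv_fun_sub (hf.differentiable (by simp) x) (hg.differentiable (by simp) x)]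
  rfl

theorem pderiv'_mul (hf : ContDiff ℝ (⊤ : ℕ∞) f) (hg : ContDiff ℝ (⊤ : ℕ∞) g) :
    pderiv' (fun y => f y * g y) i x = pderiv' f i x * g x + f x * pderiv' g i x := by
  unfold pderiv'
  rw [fderiv_fun_mul (hf.differentiable (by simp) x) (hg.differentiable (by simp) x)]
  simp only [add_apply, smul_apply, smul_eq_mul]
  ring

theorem pderiv'_sum {F : Fin d → EuclideanSpace ℝ (Fin d) → ℝ}
    (hF : ∀ j, ContDiff ℝ (⊤ : ℕ∞) (F j)) :
    pderiv' (fun y => ∑ j, F j y) i x = ∑ j, pderiv' (F j) i x := by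
  unfold pderiv'
  rw [fderiv_fun_sum fun j _ => (hF j).differentiable (by simp) x]
  simp

theorem pderiv'_exp (hf : ContDiff ℝ (⊤ : ℕ∞) f) :
    pderiv' (fun y => Real.exp (f y)) i x = Real.exp (f x) * pderiv' f i x := by
  unfold pderiv'
  rw [fderiv_exp (hf.differentiable (by simp) x)]
  rfl

theorem pderiv'_log (hf : ContDiff ℝ (⊤ : ℕ∞) f) (hx : f x ≠ 0) :
    pderiv' (fun y => Real.log (f y)) i x = (f x)⁻¹ * pderiv' f i x := by
  unfold pderiv'
  rw [fderiv.log (hf.differentiable (by simp) x) hx]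
  rfl

theorem pderiv2_comm (hf : ContDiff ℝ (⊤ : ℕ∞) f) : pderiv2 f i j x = pderiv2 f j i x := by
  have key : ∀ a b : Fin d, pderiv2 f a b x =
      fderiv ℝ (fderiv ℝ f) x (EuclideanSpace.single a 1) (EuclideanSpace.single b 1) := by
    intro a b
    have hd : DifferentiableAt ℝ (fderiv ℝ f) x :=
      (hf.fderiv_right (m := (⊤ : ℕ∞)) (by simp)).differentiable (by simp) x
    unfold pderiv2 pderiv'
    rw [fderiv_clm_apply hd (differentiableAt_const _)]
    simp
  rw [key, key]
  exact (hf.contDiffAt.isSymmSndFDerivAt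
    (by simpa using WithTop.coe_le_coe.2 (le_top (a := (2 : ℕ∞))))) _ _

/-- Third partial derivatives commute: `∂_i ∂_i ∂_j f = ∂_j ∂_i ∂_i f`. -/
theorem pderiv2_pderiv' (hf : ContDiff ℝ (⊤ : ℕ∞) f) :
    pderiv2 (fun y => pderiv' f j y) i i x = pderiv' (fun y => pderiv2 f i i y) j x := by
  calc pderiv2 (fun y => pderiv' f j y) i i x
      = pderiv' (fun y => pderiv2 f i j y) i x := rfl
    _ = pderiv' (fun y => pderiv2 f j i y) i x := by simp_rw [pderiv2_comm hf (i := i)]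
    _ = pderiv2 (fun y => pderiv' f i y) i j x := rfl
    _ = pderiv2 (fun y => pderiv' f i y) j i x := pderiv2_comm (hf.pderiv' i)

theorem pderiv'_gamma1_self (hf : ContDiff ℝ (⊤ : ℕ∞) f) :
    pderiv' (fun y => Gamma1 f f y) i x = 2 * ∑ j, pderiv' f j x * pderiv2 f i j x := by
  unfold Gamma1
  rw [pderiv'_sum fun j => (hf.pderiv' j).mul (hf.pderiv' j), Finset.mul_sum]
  refine Finset.sum_congr rfl fun j _ => ?_
  rw [pderiv'_mul (hf.pderiv' j) (hf.pderiv' j)]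
  unfold pderiv2
  ring

theorem lap_gamma1_self (hf : ContDiff ℝ (⊤ : ℕ∞) f) :
    lap (fun y => Gamma1 f f y) x = 2 * ∑ i, ∑ j,
      ((pderiv2 f i j x) ^ 2 + pderiv' f j x * pderiv' (fun y => pderiv2 f i i y) j x) := by
  unfold lap
  rw [Finset.mul_sum]
  refine Finset.sum_congr rfl fun i _ => ?_
  have h : ∀ j, ContDiff ℝ (⊤ : ℕ∞) (fun y => pderiv' f j y * pderiv2 f i j y) := fun j =>
    (hf.pderiv' j).mul ((hf.pderiv' j).pderiv' i)
  rw [pderiv2]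
  simp_rw [pderiv'_gamma1_self hf]
  rw [pderiv'_mul contDiff_const (ContDiff.sum fun j _ => h j), pderiv'_sum h]
  have hc : pderiv' (fun _ : EuclideanSpace ℝ (Fin d) => (2 : ℝ)) i x = 0 := by simp [pderiv']
  rw [hc, zero_mul, zero_add]
  congr 1
  refine Finset.sum_congr rfl fun j _ => ?_
  rw [← pderiv2_pderiv' hf]
  unfold pderiv2
  rw [pderiv'_mul (hf.pderiv' j) ((hf.pderiv' j).pderiv' i)]
  ring

theorem integrable_pderiv' (hf : ContDiff ℝ (⊤ : ℕ∞) f) (hfc : HasCompactSupport f) :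
    Integrable (fun y => pderiv' f i y) :=
  ((hf.pderiv' i).continuous).integrable_of_hasCompactSupport (hfc.fderiv_apply (𝕜 := ℝ) _)

theorem integral_pderiv'_eq_zero (hf : ContDiff ℝ (⊤ : ℕ∞) f) (hfc : HasCompactSupport f) :
    ∫ y, pderiv' f i y = 0 := by
  have hint : Integrable (fun y => fderiv ℝ f y (EuclideanSpace.single i 1)) :=
    integrable_pderiv' hf hfc
  have := integral_mul_fderiv_eq_neg_fderiv_mul_of_integrable (μ := volume)
    (f := fun _ : EuclideanSpace ℝ (Fin d) => (1 : ℝ)) (g := f)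
    (v := EuclideanSpace.single i (1 : ℝ)) (by simp) (by simpa using hint)
    (by simpa using hf.continuous.integrable_of_hasCompactSupport hfc)
    (fun _ _ => differentiableAt_const _) (fun y _ => hf.differentiable (by simp) y)
  simpa [pderiv'] using this

end Calculus

theorem integral_add_of_integral_eq_zero {α : Type*} [MeasurableSpace α] {μ : Measure α}
    {f g : α → ℝ} (hg : Integrable g μ) (h0 : ∫ x, g x ∂μ = 0) :
    ∫ x, (f x + g x) ∂μ = ∫ x, f x ∂μ := by
  by_cases hf : Integrable f μ
  · rw [integral_add hf hg, h0, add_zero]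
  · rw [integral_undef hf, integral_undef]
    exact fun h => hf ((integrable_add_iff_integrable_left' hg).mp h)

section Bochner

variable {d : ℕ} {π f : EuclideanSpace ℝ (Fin d) → ℝ}
  {γ : EuclideanSpace ℝ (Fin d) → EuclideanSpace ℝ (Fin d)}

/-- Bochner's formula `Γ₂(f,f) = ‖∇²f‖_F² − ∇² log π (∇f, ∇f)`. -/
theorem gamma2_eq (hπ : ContDiff ℝ (⊤ : ℕ∞) π) (hπpos : ∀ x, 0 < π x)
    (hf : ContDiff ℝ (⊤ : ℕ∞) f) (x : EuclideanSpace ℝ (Fin d)) :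
    Gamma2 π f x = (∑ i, ∑ j, (pderiv2 f i j x) ^ 2)
      - ∑ i, ∑ j, pderiv2 (fun y => Real.log (π y)) i j x * pderiv' f i x * pderiv' f j x := by
  have hu : ContDiff ℝ (⊤ : ℕ∞) (fun y => Real.log (π y)) := hπ.log fun y => (hπpos y).ne'
  unfold Gamma2 genL
  rw [lap_gamma1_self hf]
  generalize (fun y => Real.log (π y)) = u at hu ⊢
  have hlap : ∀ i, ContDiff ℝ (⊤ : ℕ∞) (fun y => pderiv2 f i i y) := fun i =>
    (hf.pderiv' i).pderiv' i
  have hL : ∀ i, pderiv' (fun y => Gamma1 u f y + lap f y) i x =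
      ∑ j, (pderiv2 u i j x * pderiv' f j x + pderiv' u j x * pderiv2 f j i x
        + pderiv' (fun y => pderiv2 f j j y) i x) := by
    intro i
    unfold lap
    rw [pderiv'_add (hu.gamma1 hf) (ContDiff.sum fun j _ => hlap j)]
    unfold Gamma1
    rw [pderiv'_sum hlap, pderiv'_sum fun j => (hu.pderiv' j).mul (hf.pderiv' j),
      ← Finset.sum_add_distrib]
    refine Finset.sum_congr rfl fun j _ => ?_
    rw [pderiv'_mul (hu.pderiv' j) (hf.pderiv' j), pderiv2_comm hf (i := j)]
    rfl
  have h1 : Gamma1 u (fun y => Gamma1 f f y) x =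
      2 * ∑ i, ∑ j, pderiv' u i x * (pderiv' f j x * pderiv2 f i j x) := by
    unfold Gamma1
    rw [Finset.mul_sum]
    refine Finset.sum_congr rfl fun i _ => ?_
    have := pderiv'_gamma1_self hf (i := i) (x := x)
    unfold Gamma1 at this
    rw [this, ← Finset.mul_sum]
    ring
  have h2 : Gamma1 (fun y => Gamma1 u f y + lap f y) f x =
      (∑ i, ∑ j, pderiv2 u i j x * pderiv' f i x * pderiv' f j x)
      + (∑ i, ∑ j, pderiv' u i x * (pderiv' f j x * pderiv2 f i j x))
      + ∑ i, ∑ j, pderiv' f j x * pderiv' (fun y => pderiv2 f i i y) j x := by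
    rw [Gamma1]
    simp_rw [hL]
    rw [Finset.sum_comm (f := fun i j => pderiv' u i x * _),
      Finset.sum_comm (f := fun i j => pderiv' f j x * pderiv' (fun y => pderiv2 f i i y) j x),
      ← Finset.sum_add_distrib, ← Finset.sum_add_distrib]
    refine Finset.sum_congr rfl fun i _ => ?_
    rw [Finset.sum_mul, ← Finset.sum_add_distrib, ← Finset.sum_add_distrib]
    refine Finset.sum_congr rfl fun j _ => ?_
    ring
  rw [h1, h2]
  simp only [Finset.sum_add_distrib]
  ring

/-- The vector field `π e^f (⟨γ, ∇f⟩ ∇f − |∇f|² γ)`. -/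
def currentField (π : EuclideanSpace ℝ (Fin d) → ℝ)
    (γ : EuclideanSpace ℝ (Fin d) → EuclideanSpace ℝ (Fin d))
    (f : EuclideanSpace ℝ (Fin d) → ℝ) (i : Fin d) (x : EuclideanSpace ℝ (Fin d)) : ℝ :=
  π x * Real.exp (f x) * ((∑ j, pderiv' f j x * γ x j) * pderiv' f i x - γ x i * Gamma1 f f x)

theorem contDiff_currentField (hπ : ContDiff ℝ (⊤ : ℕ∞) π) (hγ : ContDiff ℝ (⊤ : ℕ∞) γ)
    (hf : ContDiff ℝ (⊤ : ℕ∞) f) (i : Fin d) :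
    ContDiff ℝ (⊤ : ℕ∞) (currentField π γ f i) := by
  have hγi := contDiff_euclidean.1 hγ
  exact (hπ.mul hf.exp).mul (((ContDiff.sum fun j _ => (hf.pderiv' j).mul (hγi j)).mul
    (hf.pderiv' i)).sub ((hγi i).mul (hf.gamma1 hf)))

theorem hasCompactSupport_currentField (hfc : HasCompactSupport f) (i : Fin d) :
    HasCompactSupport (currentField π γ f i) := by
  refine (hfc.fderiv (𝕜 := ℝ)).mono' fun x hx => subset_closure fun h0 => hx ?_
  have h0' : fderiv ℝ f x = 0 := h0
  simp [currentField, Gamma1, pderiv', h0']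

theorem sum_pderiv'_currentField (hπ : ContDiff ℝ (⊤ : ℕ∞) π) (hπpos : ∀ x, 0 < π x)
    (hγ : ContDiff ℝ (⊤ : ℕ∞) γ) (hf : ContDiff ℝ (⊤ : ℕ∞) f)
    (hstat : ∀ x, ∑ i, pderiv' (fun y => π y * γ y i) i x = 0)
    (x : EuclideanSpace ℝ (Fin d)) :
    ∑ i, pderiv' (currentField π γ f i) i x =
      (GammaI π γ f x + ∑ i, ∑ j, pderiv' (fun y => γ y j) i x * pderiv' f i x * pderiv' f j x)
        * (π x * Real.exp (f x)) := by
  have hγi := contDiff_euclidean.1 hγ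
  have hlog : ∀ i, pderiv' π i x = π x * pderiv' (fun y => Real.log (π y)) i x := fun i => by
    rw [pderiv'_log hπ (hπpos x).ne', mul_inv_cancel_left₀ (hπpos x).ne']
  have hdiv : (∑ i, pderiv' (fun y => Real.log (π y)) i x * γ x i)
      + ∑ i, pderiv' (fun y => γ y i) i x = 0 := by
    have h := hstat x
    simp_rw [pderiv'_mul hπ (hγi _), hlog, mul_assoc, ← mul_add, ← Finset.mul_sum] at h
    rw [← Finset.sum_add_distrib]
    exact (mul_eq_zero.1 h).resolve_left (hπpos x).ne'
  have hG := ContDiff.sum (s := Finset.univ) fun j _ => (hf.pderiv' j).mul (hγi j)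
  have hGd : ∀ i, pderiv' (fun y => ∑ j, pderiv' f j y * γ y j) i x =
      ∑ j, (pderiv2 f i j x * γ x j + pderiv' f j x * pderiv' (fun y => γ y j) i x) := fun i => by
    rw [pderiv'_sum fun j => (hf.pderiv' j).mul (hγi j)]
    exact Finset.sum_congr rfl fun j _ => pderiv'_mul (hf.pderiv' j) (hγi j)
  have hW : ∀ i, pderiv' (currentField π γ f i) i x = π x * Real.exp (f x) *
      ((pderiv' (fun y => Real.log (π y)) i x + pderiv' f i x)
          * ((∑ j, pderiv' f j x * γ x j) * pderiv' f i x - γ x i * Gamma1 f f x)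
        + ((∑ j, (pderiv2 f i j x * γ x j + pderiv' f j x * pderiv' (fun y => γ y j) i x))
            * pderiv' f i x
          + (∑ j, pderiv' f j x * γ x j) * pderiv2 f i i x
          - (pderiv' (fun y => γ y i) i x * Gamma1 f f x
            + γ x i * (2 * ∑ j, pderiv' f j x * pderiv2 f i j x)))) := fun i => by
    unfold currentField
    rw [pderiv'_mul (hπ.mul hf.exp) ((hG.mul (hf.pderiv' i)).sub ((hγi i).mul (hf.gamma1 hf))),
      pderiv'_mul hπ hf.exp, pderiv'_exp hf, hlog,
      pderiv'_sub (hG.mul (hf.pderiv' i)) ((hγi i).mul (hf.gamma1 hf)),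
      pderiv'_mul hG (hf.pderiv' i), pderiv'_mul (hγi i) (hf.gamma1 hf), hGd,
      pderiv'_gamma1_self hf]
    unfold pderiv2
    ring
  have hB : ∑ i, (∑ j, pderiv2 f i j x * γ x j) * pderiv' f i x =
      ∑ i, γ x i * ∑ j, pderiv' f j x * pderiv2 f i j x := by
    simp_rw [Finset.sum_mul, Finset.mul_sum]
    rw [Finset.sum_comm]
    refine Finset.sum_congr rfl fun i _ => Finset.sum_congr rfl fun j _ => ?_
    rw [pderiv2_comm hf]
    ring
  have hA : ∑ i, (∑ j, pderiv' f j x * pderiv' (fun y => γ y j) i x) * pderiv' f i x =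
      ∑ i, ∑ j, pderiv' (fun y => γ y j) i x * pderiv' f i x * pderiv' f j x := by
    simp_rw [Finset.sum_mul]
    refine Finset.sum_congr rfl fun i _ => Finset.sum_congr rfl fun j _ => ?_
    ring
  simp_rw [hW]
  rw [← Finset.mul_sum, ← hA, mul_comm]
  congr 1
  unfold GammaI
  simp_rw [pderiv'_gamma1_self hf]
  unfold genL lap
  have h2 : ∑ i, γ x i * (2 * ∑ j, pderiv' f j x * pderiv2 f i j x) =
      2 * ∑ i, γ x i * ∑ j, pderiv' f j x * pderiv2 f i j x := by
    rw [Finset.mul_sum]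
    exact Finset.sum_congr rfl fun i _ => by ring
  have hT : ∑ i, (pderiv' (fun y => Real.log (π y)) i x + pderiv' f i x)
          * ((∑ j, pderiv' f j x * γ x j) * pderiv' f i x - γ x i * Gamma1 f f x) =
      (∑ j, pderiv' f j x * γ x j) * Gamma1 (fun y => Real.log (π y)) f x
        - (∑ i, pderiv' (fun y => Real.log (π y)) i x * γ x i) * Gamma1 f f x := by
    generalize hN : Gamma1 f f x = N
    generalize hS : ∑ j, pderiv' f j x * γ x j = G
    have : ∑ i, (pderiv' f i x) * (G * pderiv' f i x - γ x i * N) = G * N - G * N := by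
      conv_rhs =>
        congr
        · rw [← hN, Gamma1, Finset.mul_sum]
        · rw [← hS, Finset.sum_mul]
      rw [← Finset.sum_sub_distrib]
      exact Finset.sum_congr rfl fun i _ => by ring
    simp_rw [add_mul]
    rw [Finset.sum_add_distrib, this]
    unfold Gamma1
    rw [Finset.mul_sum, Finset.sum_mul, sub_self, add_zero, ← Finset.sum_sub_distrib]
    exact Finset.sum_congr rfl fun i _ => by ring
  rw [Finset.sum_add_distrib, hT]
  simp only [Finset.sum_sub_distrib, Finset.sum_add_distrib, add_mul _ _ (pderiv' f _ x)]
  rw [h2, hB, ← Finset.mul_sum, ← Finset.sum_mul]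
  linear_combination (-Gamma1 f f x) * hdiv

theorem sum_RAC_mul (x : EuclideanSpace ℝ (Fin d)) :
    ∑ i, ∑ j, RAC π γ i j x * pderiv' f i x * pderiv' f j x =
      -(∑ i, ∑ j, pderiv2 (fun y => Real.log (π y)) i j x * pderiv' f i x * pderiv' f j x)
      - ∑ i, ∑ j, pderiv' (fun y => γ y j) i x * pderiv' f i x * pderiv' f j x := by
  have h : ∑ i, ∑ j, pderiv' (fun y => γ y i) j x * pderiv' f i x * pderiv' f j x =
      ∑ i, ∑ j, pderiv' (fun y => γ y j) i x * pderiv' f i x * pderiv' f j x := by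
    rw [Finset.sum_comm]
    exact Finset.sum_congr rfl fun i _ => Finset.sum_congr rfl fun j _ => by ring
  have h' : ∀ i j, RAC π γ i j x * pderiv' f i x * pderiv' f j x =
      -(pderiv2 (fun y => Real.log (π y)) i j x * pderiv' f i x * pderiv' f j x)
      - (1 / 2 * (pderiv' (fun y => γ y j) i x * pderiv' f i x * pderiv' f j x)
        + 1 / 2 * (pderiv' (fun y => γ y i) j x * pderiv' f i x * pderiv' f j x)) :=
    fun i j => by unfold RAC; ring
  simp_rw [h', Finset.sum_sub_distrib, Finset.sum_add_distrib, ← Finset.mul_sum,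
    Finset.sum_neg_distrib]
  rw [h]
  ring

end Bochner

/-- Proposition 3.4: weak formulation via the Arnold–Carlen tensor, with `p = π e^f`:
`∫ (Γ₂(f,f) + Γ_I(f,f)) p = ∫ (‖∇²f‖_F² + ℜ_AC(∇f, ∇f)) p`. -/
theorem arnold_carlen_weak_formulation
    (d : ℕ) (hd : 1 ≤ d)
    (π : EuclideanSpace ℝ (Fin d) → ℝ) (hπ : ContDiff ℝ (⊤ : ℕ∞) π)
    (hπpos : ∀ x, 0 < π x)
    (γ : EuclideanSpace ℝ (Fin d) → EuclideanSpace ℝ (Fin d))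
    (hγ : ContDiff ℝ (⊤ : ℕ∞) γ)
    (hstat : ∀ x, ∑ i, pderiv' (fun y => π y * γ y i) i x = 0)
    (f : EuclideanSpace ℝ (Fin d) → ℝ) (hf : ContDiff ℝ (⊤ : ℕ∞) f)
    (hfc : HasCompactSupport f) :
    ∫ x, (Gamma2 π f x + GammaI π γ f x) * (π x * Real.exp (f x)) =
      ∫ x, ((∑ i, ∑ j, (pderiv2 f i j x) ^ 2)
          + ∑ i, ∑ j, RAC π γ i j x * pderiv' f i x * pderiv' f j x)
        * (π x * Real.exp (f x)) := by
  have hW := contDiff_currentField hπ hγ hf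
  have hWc := hasCompactSupport_currentField (π := π) (γ := γ) hfc
  have hint : ∀ i ∈ Finset.univ, Integrable (fun x => pderiv' (currentField π γ f i) i x) :=
    fun i _ => integrable_pderiv' (hW i) (hWc i)
  have h0 : ∫ x, ∑ i, pderiv' (currentField π γ f i) i x = 0 := by
    rw [integral_finsetSum _ hint]
    exact Finset.sum_eq_zero fun i _ => integral_pderiv'_eq_zero (hW i) (hWc i)
  refine Eq.trans (integral_congr_ae (.of_forall fun x => ?_))
    (integral_add_of_integral_eq_zero (integrable_finsetSum _ hint) h0)
  dsimp only
  rw [sum_pderiv'_currentField hπ hπpos hγ hf hstat, gamma2_eq hπ hπpos hf, sum_RAC_mul]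
  ring

end
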